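/- Let g : 2^N → ℝ≥0 be a non-negative submodular function, and let B be a random subset of N containing every element of N with probability at most q (not necessarily independently). Then E[g(B)] ≥ (1 - q) · g(∅). -/

import Mathlib

/-- Lemma 2.2 of BFNS14: for a non-negative submodular `g` and a random set `B`
(with distribution `μ`) containing each element with probability at most `q`,
`E[g(B)] ≥ (1-q)·g(∅)`. -/
theorem stmt2 {α : Type*} [Fintype α] [DecidableEq α] (g : Finset α → ℝ)
    (hnn : ∀ S : Finset α, 0 ≤ g S)
    (hsub : ∀ X Y : Finset α, g X + g Y ≥ g (X ∪ Y) + g (X ∩ Y))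
    (μ : PMF (Finset α)) (q : ℝ) (hq0 : 0 ≤ q) (hq1 : q ≤ 1)
    (hmarg : ∀ x : α,
      ∑ S ∈ Finset.univ.filter (fun S : Finset α => x ∈ S), (μ S).toReal ≤ q) :
    ∑ S : Finset α, (μ S).toReal * g S ≥ (1 - q) * g ∅ := by
  classical
  set w : Finset α → ℝ := fun S => (μ S).toReal with hw
  have hw0 : ∀ S, 0 ≤ w S := fun S => ENNReal.toReal_nonneg
  have hw1 : ∑ S, w S = 1 := by
    have h := μ.tsum_coe
    rw [tsum_fintype] at h
    rw [hw, ← ENNReal.toReal_sum (fun a _ => μ.apply_ne_top a), h]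
    rfl
  set p : α → ℝ := fun x => ∑ S ∈ Finset.univ.filter (fun S : Finset α => x ∈ S), w S with hp
  have hp0 : ∀ x, 0 ≤ p x := fun x => Finset.sum_nonneg (fun S _ => hw0 S)
  have key : ∀ A : Finset α, ∀ c : ℝ, 0 ≤ c → c ≤ q → (∀ x ∈ A, c ≤ p x) →
      (1 - q) * g ∅ + c * g A ≤ ∑ S, w S * g (S ∩ A) := by
    intro A
    induction A using Finset.induction_on_min_value p with
    | empty =>
      intro c _ hcq _
      simp only [Finset.inter_empty]
      rw [← Finset.sum_mul, hw1]
      nlinarith [hnn ∅]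
    | insert u A hu hmin ih =>
      intro c _ _ hcA
      have h1 := ih (p u) (hp0 u) (hmarg u) hmin
      have hcu := hcA u (Finset.mem_insert_self u A)
      have h2 : ∑ S, w S * g (S ∩ A) + p u * (g (insert u A) - g A)
          ≤ ∑ S, w S * g (S ∩ insert u A) := by
        rw [hp]
        simp only []
        rw [Finset.sum_filter, Finset.sum_mul, ← Finset.sum_add_distrib]
        apply Finset.sum_le_sum
        intro S _
        by_cases hS : u ∈ S
        · have h3 := hsub (S ∩ insert u A) A
          have e1 : S ∩ insert u A ∪ A = insert u A := by grind
          have e2 : S ∩ insert u A ∩ A = S ∩ A := by grind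
          rw [e1, e2] at h3
          rw [if_pos hS]
          nlinarith [hw0 S]
        · have e1 : S ∩ insert u A = S ∩ A := by grind
          rw [if_neg hS, e1]
          simp
      nlinarith [hnn (insert u A)]
  have h := key Finset.univ 0 le_rfl hq0 (fun x _ => hp0 x)
  simp only [Finset.inter_univ, zero_mul, add_zero] at h
  exact h
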